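/- Reduction correctness for the undecidability of validity of two-variable dependence logic: let T be a finite nonempty set of tiles, let φ_T be a two-variable first-order sentence over {H,V} ∪ {P_t : t ∈ T} such that for every {V,H}-structure 𝔄, 𝔄 is not T-tilable iff every expansion of 𝔄 to {H,V} ∪ {P_t : t ∈ T} satisfies φ_T, and let φ_non-grid be the two-variable dependence-logic sentence over {V,H,C,U,P,Q} characterizing failure of being striped and gridlike (𝔄 striped and gridlike iff 𝔄 ⊭ φ_non-grid). Then the grid 𝔊 is not T-tilable if and only if the sentence φ_non-grid ∨ φ_T is valid, i.e., true in every structure over the vocabulary {V,H,C,U,P,Q} ∪ {P_t : t ∈ T}. -/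

import Mathlib

/-- A relational signature: a type of relation symbols with arities. -/
structure Signature : Type 1 where
  Rel : Type
  arity : Rel → ℕ

/-- A relational structure over a signature. -/
structure Struc (σ : Signature) : Type 1 where
  A : Type
  interp : (r : σ.Rel) → (Fin (σ.arity r) → A) → Prop

/-- A generalized atom of type `(ty 0, ..., ty (t-1))`, given by a generalized
quantifier `Q`: a class of structures `(A, B_1, ..., B_t)` with `B_j ⊆ A^{ty j}`. -/
structure GenAtom : Type 1 where
  t : ℕ
  ty : Fin t → ℕ
  Q : (A : Type) → ((j : Fin t) → Set (Fin (ty j) → A)) → Prop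

/-- Formulas of `FO(𝒜)` in negation normal form. Variables are natural numbers;
`ga : ι → GenAtom` is the collection 𝒜 of generalized atoms. -/
inductive Fml (σ : Signature) {ι : Type} (ga : ι → GenAtom) : Type where
  | rel (r : σ.Rel) (v : Fin (σ.arity r) → ℕ)
  | nrel (r : σ.Rel) (v : Fin (σ.arity r) → ℕ)
  | eq (m n : ℕ)
  | neq (m n : ℕ)
  | and (φ ψ : Fml σ ga)
  | or (φ ψ : Fml σ ga)
  | ex (x : ℕ) (φ : Fml σ ga)
  | all (x : ℕ) (φ : Fml σ ga)
  | atom (i : ι) (v : (j : Fin (ga i).t) → Fin ((ga i).ty j) → ℕ)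

/-- The updated assignment `s[a/x]`. -/
def upd {A : Type} (s : ℕ → A) (x : ℕ) (a : A) : ℕ → A :=
  fun n => if n = x then a else s n

/-- `rel(X, ȳ)`: the relation that a team `X` induces via a tuple `v` of variables. -/
def relOf {A : Type} (X : Set (ℕ → A)) {m : ℕ} (v : Fin m → ℕ) : Set (Fin m → A) :=
  (fun s => fun k => s (v k)) '' X

variable {σ : Signature} {ι : Type} {ga : ι → GenAtom}

/-- Lax team semantics for `FO(𝒜)`. A team is a set of assignments `ℕ → M.A`. -/
def TSat (M : Struc σ) : Fml σ ga → Set (ℕ → M.A) → Prop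
  | .rel r v, X => ∀ s ∈ X, M.interp r (fun k => s (v k))
  | .nrel r v, X => ∀ s ∈ X, ¬ M.interp r (fun k => s (v k))
  | .eq m n, X => ∀ s ∈ X, s m = s n
  | .neq m n, X => ∀ s ∈ X, s m ≠ s n
  | .and φ ψ, X => TSat M φ X ∧ TSat M ψ X
  | .or φ ψ, X => ∃ Y Z, X = Y ∪ Z ∧ TSat M φ Y ∧ TSat M ψ Z
  | .ex x φ, X => ∃ F : (ℕ → M.A) → Set M.A, (∀ s ∈ X, (F s).Nonempty) ∧
      TSat M φ {s' | ∃ s ∈ X, ∃ a ∈ F s, s' = upd s x a}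
  | .all x φ, X => TSat M φ {s' | ∃ s ∈ X, ∃ a : M.A, s' = upd s x a}
  | .atom i v, X => (ga i).Q M.A (fun j => relOf X (v j))

/-- The set of free variables of a formula. -/
def Fr : Fml σ ga → Set ℕ
  | .rel _ v => Set.range v
  | .nrel _ v => Set.range v
  | .eq m n => {m, n}
  | .neq m n => {m, n}
  | .and φ ψ => Fr φ ∪ Fr ψ
  | .or φ ψ => Fr φ ∪ Fr ψ
  | .ex x φ => Fr φ \ {x}
  | .all x φ => Fr φ \ {x}
  | .atom _ v => ⋃ j, Set.range (v j)

/-- The set of all variables occurring in a formula (free or bound). -/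
def Vars : Fml σ ga → Set ℕ
  | .rel _ v => Set.range v
  | .nrel _ v => Set.range v
  | .eq m n => {m, n}
  | .neq m n => {m, n}
  | .and φ ψ => Vars φ ∪ Vars ψ
  | .or φ ψ => Vars φ ∪ Vars ψ
  | .ex x φ => insert x (Vars φ)
  | .all x φ => insert x (Vars φ)
  | .atom _ v => ⋃ j, Set.range (v j)

/-- Truth of a sentence `φ` in a structure `M`: satisfaction by the team of all
assignments, which (for sentences, by locality) represents satisfaction by the
team `{∅}` containing only the empty assignment. -/
def TTrue (M : Struc σ) (φ : Fml σ ga) : Prop :=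
  TSat M φ (Set.univ : Set (ℕ → M.A))

/-- The vertical successor relation of the grid ℕ²: `V((i,j),(i,j+1))`. -/
def gridV : ℕ × ℕ → ℕ × ℕ → Prop := fun u w => w.1 = u.1 ∧ w.2 = u.2 + 1

/-- The horizontal successor relation of the grid ℕ²: `H((i,j),(i+1,j))`. -/
def gridH : ℕ × ℕ → ℕ × ℕ → Prop := fun u w => w.1 = u.1 + 1 ∧ w.2 = u.2

/-- A `{V,H}`-structure `(A, V, H)` is gridlike if `V` and `H` are serial and
whenever `V(a,b)`, `H(b,c)`, `H(a,b')`, `V(b',c')`, then `c = c'`. -/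
def Gridlike {A : Type} (V H : A → A → Prop) : Prop :=
  (∀ a, ∃ b, V a b) ∧ (∀ a, ∃ b, H a b) ∧
  (∀ a b c b' c', V a b → H b c → H a b' → V b' c' → c = c')

/-- A `{V,H,C,U,P,Q}`-structure is striped and gridlike if its `{V,H}`-reduct
is gridlike, the extensions of `P` and `Q` are distinct singletons, the
extension of `U` is their union, and `C` creates stripes: `H(a,b)` implies
`(C(a) ⇔ C(b))` and `V(a,b)` implies `(C(a) ⇔ ¬C(b))`. -/
def StripedGridlike {A : Type} (V H : A → A → Prop) (C U P Q : Set A) : Prop :=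
  Gridlike V H ∧
  (∃ p, P = {p}) ∧ (∃ q, Q = {q}) ∧ P ≠ Q ∧ U = P ∪ Q ∧
  (∀ a b, H a b → (a ∈ C ↔ b ∈ C)) ∧
  (∀ a b, V a b → (a ∈ C ↔ b ∉ C))

/-- A tile type is a function `t : {0,1,2,3} → ℕ`; `t 0` is the top, `t 1` the
right, `t 2` the bottom and `t 3` the left colour. A `{V,H}`-structure is
`T`-tilable (for a finite set `T` of tiles) if it has an expansion by unary
predicates `P t` (`t ∈ T`) such that every point is in exactly one `P t`
(`t ∈ T`), horizontally adjacent tiles match in their right/left colours and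
vertically adjacent tiles match in their top/bottom colours. -/
def Tilable {A : Type} (V H : A → A → Prop) (T : Finset (Fin 4 → ℕ)) : Prop :=
  ∃ P : (Fin 4 → ℕ) → Set A,
    (∀ a : A, ∃! t, t ∈ T ∧ a ∈ P t) ∧
    (∀ u v : A, ∀ t s : Fin 4 → ℕ, t ∈ T → s ∈ T →
      H u v → u ∈ P t → v ∈ P s → t 1 = s 3) ∧
    (∀ u v : A, ∀ t s : Fin 4 → ℕ, t ∈ T → s ∈ T →
      V u v → u ∈ P t → v ∈ P s → t 0 = s 2)

/-- The dependence atom `=(x_1,...,x_n,y)` as a generalized atom of type `(n+1)`. -/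
def depAtom (n : ℕ) : GenAtom where
  t := 1
  ty := fun _ => n + 1
  Q := fun A R => ∀ w ∈ R 0, ∀ w' ∈ R 0,
    (∀ i : Fin n, w i.castSucc = w' i.castSucc) → w (Fin.last n) = w' (Fin.last n)

/-- The relation symbols of the vocabulary `{V, H, C, U, P, Q}`. -/
inductive GRel : Type where
  | V | H | C | U | P | Q
deriving DecidableEq

/-- The vocabulary `{V, H, C, U, P, Q} ∪ {P_t : t ∈ T}`. -/
def redSig (T : Finset (Fin 4 → ℕ)) : Signature :=
  ⟨GRel ⊕ {t : Fin 4 → ℕ // t ∈ T}, fun r => match r with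
    | .inl .V => 2 | .inl .H => 2
    | .inl .C => 1 | .inl .U => 1 | .inl .P => 1 | .inl .Q => 1
    | .inr _ => 1⟩

/-- The `{V,H,C,U,P,Q} ∪ {P_t : t ∈ T}`-structure determined by the data. -/
def mkRed (T : Finset (Fin 4 → ℕ)) (A : Type) (Vr Hr : A → A → Prop)
    (Cs Us Ps Qs : Set A) (Pt : {t : Fin 4 → ℕ // t ∈ T} → Set A) :
    Struc (redSig T) :=
  ⟨A, fun r => match r with
    | .inl .V => fun w => Vr (w (0 : Fin 2)) (w (1 : Fin 2))
    | .inl .H => fun w => Hr (w (0 : Fin 2)) (w (1 : Fin 2))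
    | .inl .C => fun w => w (0 : Fin 1) ∈ Cs
    | .inl .U => fun w => w (0 : Fin 1) ∈ Us
    | .inl .P => fun w => w (0 : Fin 1) ∈ Ps
    | .inl .Q => fun w => w (0 : Fin 1) ∈ Qs
    | .inr t => fun w => w (0 : Fin 1) ∈ Pt t⟩

/-- Formulas containing no generalized atoms, i.e. plain first-order formulas. -/
def NoAtoms {σ : Signature} {ι : Type} {ga : ι → GenAtom} : Fml σ ga → Prop
  | .rel _ _ => True
  | .nrel _ _ => True
  | .eq _ _ => True
  | .neq _ _ => True
  | .and φ ψ => NoAtoms φ ∧ NoAtoms ψ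
  | .or φ ψ => NoAtoms φ ∧ NoAtoms ψ
  | .ex _ φ => NoAtoms φ
  | .all _ φ => NoAtoms φ
  | .atom _ _ => False

/-- Two teams have the same set of restrictions to `W`. -/
def TeamEqOn {A : Type} (W : Set ℕ) (X X' : Set (ℕ → A)) : Prop :=
  (∀ s ∈ X, ∃ s' ∈ X', Set.EqOn s s' W) ∧ (∀ s' ∈ X', ∃ s ∈ X, Set.EqOn s s' W)

theorem upd_eqOn_insert {A : Type} {W : Set ℕ} {s s' : ℕ → A} (h : Set.EqOn s s' W)
    (x : ℕ) (a : A) : Set.EqOn (upd s x a) (upd s' x a) (insert x W) := by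
  intro n hn
  by_cases hx : n = x
  · simp [upd, hx]
  · simpa [upd, hx] using h (hn.resolve_left hx)

theorem relOf_eq_of_teamEqOn {A : Type} {W : Set ℕ} {X X' : Set (ℕ → A)}
    (h : TeamEqOn W X X') {m : ℕ} {v : Fin m → ℕ} (hv : Set.range v ⊆ W) :
    relOf X v = relOf X' v := by
  ext w
  constructor
  · rintro ⟨s, hs, rfl⟩
    obtain ⟨s', hs', he⟩ := h.1 s hs
    exact ⟨s', hs', funext fun k => (he (hv ⟨k, rfl⟩)).symm⟩
  · rintro ⟨s', hs', rfl⟩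
    obtain ⟨s, hs, he⟩ := h.2 s' hs'
    exact ⟨s, hs, funext fun k => he (hv ⟨k, rfl⟩)⟩

/-- Locality: satisfaction depends only on the restrictions of the assignments in the team to
the free variables. -/
theorem TSat.of_teamEqOn (M : Struc σ) (φ : Fml σ ga) {W : Set ℕ} {X X' : Set (ℕ → M.A)}
    (hW : Fr φ ⊆ W) (h : TeamEqOn W X X') (hX : TSat M φ X) : TSat M φ X' := by
  induction φ generalizing W X X' with
  | rel r v =>
    intro s' hs'
    obtain ⟨s, hs, he⟩ := h.2 s' hs'
    have hk : (fun k => s' (v k)) = fun k => s (v k) :=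
      funext fun k => (he (hW ⟨k, rfl⟩)).symm
    rw [hk]
    exact hX s hs
  | nrel r v =>
    intro s' hs'
    obtain ⟨s, hs, he⟩ := h.2 s' hs'
    have hk : (fun k => s' (v k)) = fun k => s (v k) :=
      funext fun k => (he (hW ⟨k, rfl⟩)).symm
    rw [hk]
    exact hX s hs
  | eq m n =>
    intro s' hs'
    obtain ⟨s, hs, he⟩ := h.2 s' hs'
    rw [← he (hW (Or.inl rfl)), ← he (hW (Or.inr rfl))]
    exact hX s hs
  | neq m n =>
    intro s' hs'
    obtain ⟨s, hs, he⟩ := h.2 s' hs'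
    rw [← he (hW (Or.inl rfl)), ← he (hW (Or.inr rfl))]
    exact hX s hs
  | and φ ψ ihφ ihψ =>
    exact ⟨ihφ (Set.subset_union_left.trans hW) h hX.1,
      ihψ (Set.subset_union_right.trans hW) h hX.2⟩
  | or φ ψ ihφ ihψ =>
    obtain ⟨Y, Z, rfl, hY, hZ⟩ := hX
    have key : ∀ S ⊆ Y ∪ Z, TeamEqOn W S {s' ∈ X' | ∃ s ∈ S, Set.EqOn s s' W} := by
      refine fun S hS => ⟨fun s hs => ?_, fun s' hs' => hs'.2⟩
      obtain ⟨s', hs', he⟩ := h.1 s (hS hs)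
      exact ⟨s', ⟨hs', s, hs, he⟩, he⟩
    refine ⟨_, _, ?_, ihφ (Set.subset_union_left.trans hW) (key Y Set.subset_union_left) hY,
      ihψ (Set.subset_union_right.trans hW) (key Z Set.subset_union_right) hZ⟩
    ext s'
    constructor
    · intro hs'
      obtain ⟨s, hs | hs, he⟩ := h.2 s' hs'
      · exact Or.inl ⟨hs', s, hs, he⟩
      · exact Or.inr ⟨hs', s, hs, he⟩
    · rintro (hs' | hs') <;> exact hs'.1
  | ex x φ ih =>
    obtain ⟨F, hF, hsat⟩ := hX
    refine ⟨fun s' => {a | ∃ s ∈ X, Set.EqOn s s' W ∧ a ∈ F s}, fun s' hs' => ?_,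
      ih (Set.sdiff_singleton_subset_iff.1 hW) ⟨?_, ?_⟩ hsat⟩
    · obtain ⟨s, hs, he⟩ := h.2 s' hs'
      obtain ⟨a, ha⟩ := hF s hs
      exact ⟨a, s, hs, he, ha⟩
    · rintro _ ⟨s, hs, a, ha, rfl⟩
      obtain ⟨s', hs', he⟩ := h.1 s hs
      exact ⟨_, ⟨s', hs', a, ⟨s, hs, he, ha⟩, rfl⟩, upd_eqOn_insert he x a⟩
    · rintro _ ⟨s', hs', a, ⟨s, hs, he, ha⟩, rfl⟩
      exact ⟨_, ⟨s, hs, a, ha, rfl⟩, upd_eqOn_insert he x a⟩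
  | all x φ ih =>
    refine ih (Set.sdiff_singleton_subset_iff.1 hW) ⟨?_, ?_⟩ hX
    · rintro _ ⟨s, hs, a, rfl⟩
      obtain ⟨s', hs', he⟩ := h.1 s hs
      exact ⟨_, ⟨s', hs', a, rfl⟩, upd_eqOn_insert he x a⟩
    · rintro _ ⟨s', hs', a, rfl⟩
      obtain ⟨s, hs, he⟩ := h.2 s' hs'
      exact ⟨_, ⟨s, hs, a, rfl⟩, upd_eqOn_insert he x a⟩
  | atom i v =>
    have hrel : (fun j => relOf X' (v j)) = fun j => relOf X (v j) :=
      funext fun j => (relOf_eq_of_teamEqOn h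
        ((Set.subset_iUnion (fun j => Set.range (v j)) j).trans hW)).symm
    change (ga i).Q M.A (fun j => relOf X' (v j))
    rw [hrel]
    exact hX

/-- A sentence satisfied by some nonempty team is true. -/
theorem TTrue.of_nonempty {M : Struc σ} {φ : Fml σ ga} (hφ : Fr φ = ∅) {X : Set (ℕ → M.A)}
    (hne : X.Nonempty) (hX : TSat M φ X) : TTrue M φ := by
  obtain ⟨s, hs⟩ := hne
  exact TSat.of_teamEqOn M φ hφ.subset
    ⟨fun t _ => ⟨t, trivial, Set.eqOn_refl _ _⟩, fun _ _ => ⟨s, hs, Set.eqOn_empty _ _⟩⟩ hX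

/-- The empty team satisfies every formula of dependence logic. -/
theorem tsat_empty (M : Struc σ) (φ : Fml σ depAtom) : TSat M φ ∅ := by
  induction φ with
  | rel r v => exact fun s hs => hs.elim
  | nrel r v => exact fun s hs => hs.elim
  | eq m n => exact fun s hs => hs.elim
  | neq m n => exact fun s hs => hs.elim
  | and φ ψ ihφ ihψ => exact ⟨ihφ, ihψ⟩
  | or φ ψ ihφ ihψ => exact ⟨∅, ∅, by simp, ihφ, ihψ⟩
  | ex x φ ih =>
    refine ⟨fun _ => ∅, fun s hs => hs.elim, ?_⟩
    convert ih using 1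
    ext
    simp
  | all x φ ih =>
    change TSat M φ _
    convert ih using 1
    ext
    simp
  | atom i v =>
    rintro w ⟨s, hs, -⟩
    exact hs.elim

/-- On sentences, team-semantical disjunction is classical disjunction. -/
theorem ttrue_or {M : Struc σ} (hM : Nonempty M.A) {φ ψ : Fml σ depAtom} (hφ : Fr φ = ∅)
    (hψ : Fr ψ = ∅) : TTrue M (φ.or ψ) ↔ TTrue M φ ∨ TTrue M ψ := by
  constructor
  · rintro ⟨Y, Z, hYZ, hY, hZ⟩
    obtain ⟨a⟩ := hM
    have ha : (fun _ => a) ∈ Y ∪ Z := hYZ ▸ Set.mem_univ _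
    exact ha.imp (fun h => .of_nonempty hφ ⟨_, h⟩ hY) (fun h => .of_nonempty hψ ⟨_, h⟩ hZ)
  · rintro (h | h)
    · exact ⟨Set.univ, ∅, by simp, h, tsat_empty M ψ⟩
    · exact ⟨∅, Set.univ, by simp, tsat_empty M φ, h⟩

/-- Tilings pull back along homomorphisms. -/
theorem Tilable.comap {A B : Type} {V H : A → A → Prop} {V' H' : B → B → Prop}
    {T : Finset (Fin 4 → ℕ)} (h : Tilable V' H' T) (f : A → B)
    (hV : ∀ a b, V a b → V' (f a) (f b)) (hH : ∀ a b, H a b → H' (f a) (f b)) :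
    Tilable V H T := by
  obtain ⟨P, hP, hPH, hPV⟩ := h
  exact ⟨fun t => f ⁻¹' P t, fun a => hP (f a),
    fun u v t s ht hs huv => hPH _ _ t s ht hs (hH u v huv),
    fun u v t s ht hs huv => hPV _ _ t s ht hs (hV u v huv)⟩

/-- The grid maps homomorphically into every nonempty gridlike structure. -/
theorem Gridlike.exists_grid_hom {A : Type} [Nonempty A] {V H : A → A → Prop}
    (h : Gridlike V H) : ∃ f : ℕ × ℕ → A,
      (∀ u w, gridV u w → V (f u) (f w)) ∧ (∀ u w, gridH u w → H (f u) (f w)) := by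
  obtain ⟨hV, hH, hVH⟩ := h
  choose v hv using hV
  choose k hk using hH
  have hcomm : Function.Commute v k := fun a =>
    (hVH a _ _ _ _ (hv a) (hk _) (hk a) (hv _)).symm
  obtain ⟨a⟩ := ‹Nonempty A›
  refine ⟨fun u => k^[u.1] (v^[u.2] a), ?_, ?_⟩
  · rintro ⟨i, j⟩ ⟨i', j'⟩ h
    obtain ⟨rfl, rfl⟩ : i' = i ∧ j' = j + 1 := h
    change V (k^[i'] (v^[j] a)) (k^[i'] (v^[j + 1] a))
    rw [Function.iterate_succ_apply', ← (hcomm.iterate_right i').eq]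
    exact hv _
  · rintro ⟨i, j⟩ ⟨i', j'⟩ h
    obtain ⟨rfl, rfl⟩ : i' = i + 1 ∧ j' = j := h
    change H (k^[i] (v^[j'] a)) (k^[i + 1] (v^[j'] a))
    rw [Function.iterate_succ_apply']
    exact hk _

theorem stripedGridlike_grid :
    StripedGridlike gridV gridH {u | Even u.2} ({(0, 0)} ∪ {(1, 0)}) {(0, 0)} {(1, 0)} := by
  refine ⟨⟨fun a => ⟨(a.1, a.2 + 1), rfl, rfl⟩, fun a => ⟨(a.1 + 1, a.2), rfl, rfl⟩, ?_⟩,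
    ⟨_, rfl⟩, ⟨_, rfl⟩, by simp, rfl, ?_, ?_⟩
  · rintro a b c b' c' ⟨h₁, h₂⟩ ⟨h₃, h₄⟩ ⟨h₅, h₆⟩ ⟨h₇, h₈⟩
    exact Prod.ext (by omega) (by omega)
  · rintro a b ⟨-, h⟩
    simp [h]
  · rintro a b ⟨-, h⟩
    simp [h, Nat.even_add_one]

/-- reduction correctness, Theorem 19 of the paper: let `T`
be a finite nonempty set of tiles, let `φT` be a two-variable first-order
sentence (over the vocabulary `{H,V} ∪ {P_t : t ∈ T}`, hence independent of
the interpretations of `C,U,P,Q`) such that a `{V,H}`-structure is not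
`T`-tilable iff all of its expansions satisfy `φT`, and let `φng` be a
two-variable dependence-logic sentence such that a structure is striped and
gridlike iff it does not satisfy `φng`.  Then the grid is not `T`-tilable iff
`φng ∨ φT` is valid, i.e. true in every structure over the combined
vocabulary. -/
theorem nontiling_reduction_correctness (T : Finset (Fin 4 → ℕ)) (hT : T.Nonempty)
    (φT φng : Fml (redSig T) depAtom)
    (hfo : NoAtoms φT)
    (hT2var : Vars φT ⊆ ({0, 1} : Set ℕ)) (hTsen : Fr φT = ∅)
    (hng2var : Vars φng ⊆ ({0, 1} : Set ℕ)) (hngsen : Fr φng = ∅)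
    (hTinv : ∀ (A : Type), Nonempty A → ∀ (Vr Hr : A → A → Prop)
      (Cs Us Ps Qs Cs' Us' Ps' Qs' : Set A) (Pt : {t : Fin 4 → ℕ // t ∈ T} → Set A),
      (TTrue (mkRed T A Vr Hr Cs Us Ps Qs Pt) φT ↔
       TTrue (mkRed T A Vr Hr Cs' Us' Ps' Qs' Pt) φT))
    (hTchar : ∀ (A : Type), Nonempty A → ∀ (Vr Hr : A → A → Prop),
      (¬ Tilable Vr Hr T ↔
        ∀ (Cs Us Ps Qs : Set A) (Pt : {t : Fin 4 → ℕ // t ∈ T} → Set A),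
          TTrue (mkRed T A Vr Hr Cs Us Ps Qs Pt) φT))
    (hngchar : ∀ (A : Type), Nonempty A → ∀ (Vr Hr : A → A → Prop)
      (Cs Us Ps Qs : Set A) (Pt : {t : Fin 4 → ℕ // t ∈ T} → Set A),
      (StripedGridlike Vr Hr Cs Us Ps Qs ↔
        ¬ TTrue (mkRed T A Vr Hr Cs Us Ps Qs Pt) φng)) :
    ¬ Tilable gridV gridH T ↔
      ∀ (A : Type), Nonempty A → ∀ (Vr Hr : A → A → Prop)
        (Cs Us Ps Qs : Set A) (Pt : {t : Fin 4 → ℕ // t ∈ T} → Set A),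
        TTrue (mkRed T A Vr Hr Cs Us Ps Qs Pt) (Fml.or φng φT) := by
  have hor : ∀ (A : Type), Nonempty A → ∀ (Vr Hr : A → A → Prop)
      (Cs Us Ps Qs : Set A) (Pt : {t : Fin 4 → ℕ // t ∈ T} → Set A),
      TTrue (mkRed T A Vr Hr Cs Us Ps Qs Pt) (Fml.or φng φT) ↔
        (StripedGridlike Vr Hr Cs Us Ps Qs → TTrue (mkRed T A Vr Hr Cs Us Ps Qs Pt) φT) := by
    intro A hA Vr Hr Cs Us Ps Qs Pt
    rw [hngchar A hA Vr Hr Cs Us Ps Qs Pt, ← or_iff_not_imp_left]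
    exact ttrue_or (M := mkRed T A Vr Hr Cs Us Ps Qs Pt) hA hngsen hTsen
  constructor
  · intro hgrid A hA Vr Hr Cs Us Ps Qs Pt
    refine (hor A hA Vr Hr Cs Us Ps Qs Pt).2 fun hsg => ?_
    obtain ⟨f, hfV, hfH⟩ := hsg.1.exists_grid_hom
    exact (hTchar A hA Vr Hr).1 (fun hA' => hgrid (hA'.comap f hfV hfH)) Cs Us Ps Qs Pt
  · intro hvalid
    refine (hTchar (ℕ × ℕ) inferInstance gridV gridH).2 fun Cs Us Ps Qs Pt => ?_
    exact (hTinv _ inferInstance _ _ _ _ _ _ _ _ _ _ _).1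
      ((hor _ inferInstance _ _ _ _ _ _ _).1
        (hvalid _ inferInstance _ _ _ _ _ _ Pt) stripedGridlike_grid)
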